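/- arXiv:1711.05576 — 2 statements merged into one kernel-verified Lean document; each statement's English description precedes it below -/
import Mathlib

section
/- Fix γ > 1, μ, η, κ, R > 0, c_h ∈ ℝ and α ≥ 0. Let (ρ, v, p, B, ψ) be twice continuously differentiable on an open set U ⊆ ℝ_t × ℝ³ with ρ > 0 and p > 0 everywhere, and suppose the conserved variables u = (ρ, ρv, E, B, ψ) satisfy pointwise on U the resistive GLM-MHD system ∂ₜu + ∇·f^a(u) − ∇·fᵛ(u, ∇u) + φ(∇·B) = r. Then at every point of U one has ∂ₜS + ∇·(vS) − ∇·Θ = − Σ_{d=1}^{3} (∂_d w)ᵀ f_dᵛ − 2αβψ², where Θ := (wᵀf₁ᵛ, wᵀf₂ᵛ, wᵀf₃ᵛ), and the right-hand side is ≤ 0 (by the symmetric positive semi-definiteness of the viscous coefficient matrix K). -/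
open Matrix

/-- Partial derivative in coordinate direction `i` (coordinate `0` is time `t`,
coordinates `1,2,3` are space) of a scalar function on ℝ⁴ = ℝ_t × ℝ³. -/
noncomputable def pd (i : Fin 4) (f : (Fin 4 → ℝ) → ℝ) (x : Fin 4 → ℝ) : ℝ :=
  fderiv ℝ f x (Pi.single i 1)

/-- The spatial coordinate index corresponding to the space direction `d`. -/
def sp (d : Fin 3) : Fin 4 := ⟨d.1 + 1, by omega⟩

/-- Spatial partial derivative in direction `d`. -/
noncomputable def spd (d : Fin 3) (f : (Fin 4 → ℝ) → ℝ) (x : Fin 4 → ℝ) : ℝ :=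
  pd (sp d) f x

/-- The conserved variables `u = (ρ, ρv, E, B, ψ)` with total energy
`E = p/(γ−1) + ½ρ‖v‖² + ½‖B‖² + ½ψ²`. -/
noncomputable def consVar (γ : ℝ) (ρ p ψ : (Fin 4 → ℝ) → ℝ)
    (v B : Fin 3 → (Fin 4 → ℝ) → ℝ) (x : Fin 4 → ℝ) : Fin 9 → ℝ :=
  ![ρ x,
    ρ x * v 0 x, ρ x * v 1 x, ρ x * v 2 x,
    p x / (γ - 1) + (1/2) * ρ x * (∑ k, (v k x) ^ 2)
      + (1/2) * (∑ k, (B k x) ^ 2) + (1/2) * (ψ x) ^ 2,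
    B 0 x, B 1 x, B 2 x, ψ x]

/-- The advective GLM-MHD flux `f^a_d` in spatial direction `d` with GLM wave
speed `c_h`. -/
noncomputable def fadvP (γ c_h : ℝ) (ρ p ψ : (Fin 4 → ℝ) → ℝ)
    (v B : Fin 3 → (Fin 4 → ℝ) → ℝ) (d : Fin 3) (x : Fin 4 → ℝ) : Fin 9 → ℝ :=
  ![ρ x * v d x,
    ρ x * v 0 x * v d x + (p x + (1/2) * ∑ k, (B k x) ^ 2)
      * (if (0 : Fin 3) = d then 1 else 0) - B 0 x * B d x,
    ρ x * v 1 x * v d x + (p x + (1/2) * ∑ k, (B k x) ^ 2)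
      * (if (1 : Fin 3) = d then 1 else 0) - B 1 x * B d x,
    ρ x * v 2 x * v d x + (p x + (1/2) * ∑ k, (B k x) ^ 2)
      * (if (2 : Fin 3) = d then 1 else 0) - B 2 x * B d x,
    v d x * ((1/2) * ρ x * (∑ k, (v k x) ^ 2) + γ * p x / (γ - 1) + ∑ k, (B k x) ^ 2)
      - B d x * (∑ k, v k x * B k x) + c_h * ψ x * B d x,
    v d x * B 0 x - B d x * v 0 x + c_h * ψ x * (if d = 0 then 1 else 0),
    v d x * B 1 x - B d x * v 1 x + c_h * ψ x * (if d = 1 then 1 else 0),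
    v d x * B 2 x - B d x * v 2 x + c_h * ψ x * (if d = 2 then 1 else 0),
    c_h * B d x]

/-- The viscous flux `fᵛ_d` in spatial direction `d`, with viscous stress tensor
`τ = μ(∇v + (∇v)ᵀ) − (2/3)μ(∇·v)I`, heat flux term `(κ/R)∇(p/ρ)` and resistive
terms scaled by `η`. -/
noncomputable def fviscP (μ η κ R : ℝ) (ρ p : (Fin 4 → ℝ) → ℝ)
    (v B : Fin 3 → (Fin 4 → ℝ) → ℝ) (d : Fin 3) (x : Fin 4 → ℝ) : Fin 9 → ℝ :=
  let gv : Fin 3 → Fin 3 → ℝ := fun k e => spd e (v k) x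
  let gB : Fin 3 → Fin 3 → ℝ := fun k e => spd e (B k) x
  let τ : Fin 3 → Fin 3 → ℝ := fun i j =>
    μ * (gv i j + gv j i) - (2/3) * μ * (∑ k, gv k k) * (if i = j then (1 : ℝ) else 0)
  ![0,
    τ 0 d, τ 1 d, τ 2 d,
    (∑ i, τ i d * v i x) + (κ / R) * spd d (fun y => p y / ρ y) x
      + η * ∑ k, B k x * (gB k d - gB d k),
    η * (gB 0 d - gB d 0), η * (gB 1 d - gB d 1), η * (gB 2 d - gB d 2),
    0]

/-- The entropy function `S = −ρs/(γ−1)` with `s = log (p ρ^(−γ))`. -/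
noncomputable def entSP (γ : ℝ) (ρ p : (Fin 4 → ℝ) → ℝ) (x : Fin 4 → ℝ) : ℝ :=
  -(ρ x * Real.log (p x * (ρ x) ^ (-γ))) / (γ - 1)

/-- The entropy variables `w` as functions of `(t,x)`. -/
noncomputable def entWP (γ : ℝ) (ρ p ψ : (Fin 4 → ℝ) → ℝ)
    (v B : Fin 3 → (Fin 4 → ℝ) → ℝ) (x : Fin 4 → ℝ) : Fin 9 → ℝ :=
  let β : ℝ := ρ x / (2 * p x)
  let s : ℝ := Real.log (p x * (ρ x) ^ (-γ))
  ![(γ - s) / (γ - 1) - β * ∑ k, (v k x) ^ 2,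
    2 * β * v 0 x, 2 * β * v 1 x, 2 * β * v 2 x,
    -(2 * β),
    2 * β * B 0 x, 2 * β * B 1 x, 2 * β * B 2 x,
    2 * β * ψ x]

section PartialDerivativeCalculus

variable {i : Fin 4} {f g : (Fin 4 → ℝ) → ℝ} {x : Fin 4 → ℝ}

lemma pd_add (hf : DifferentiableAt ℝ f x) (hg : DifferentiableAt ℝ g x) :
    pd i (fun y => f y + g y) x = pd i f x + pd i g x := by
  simp [pd, fderiv_fun_add hf hg]

lemma pd_sub (hf : DifferentiableAt ℝ f x) (hg : DifferentiableAt ℝ g x) :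
    pd i (fun y => f y - g y) x = pd i f x - pd i g x := by
  simp [pd, fderiv_fun_sub hf hg]

lemma pd_neg : pd i (fun y => -f y) x = -pd i f x := by
  simp [pd, fderiv_fun_neg]

lemma pd_mul (hf : DifferentiableAt ℝ f x) (hg : DifferentiableAt ℝ g x) :
    pd i (fun y => f y * g y) x = pd i f x * g x + f x * pd i g x := by
  simp [pd, fderiv_fun_mul hf hg]; ring

lemma pd_const (c : ℝ) : pd i (fun _ => c) x = 0 := by
  simp [pd]

lemma pd_div_const (c : ℝ) (hf : DifferentiableAt ℝ f x) :
    pd i (fun y => f y / c) x = pd i f x / c := by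
  simp only [div_eq_mul_inv, pd_mul hf (differentiableAt_const _), pd_const]; ring

lemma pd_sq (hf : DifferentiableAt ℝ f x) :
    pd i (fun y => f y ^ 2) x = 2 * f x * pd i f x := by
  simp only [pow_two, pd_mul hf hf]; ring

lemma differentiableAt_div (hf : DifferentiableAt ℝ f x) (hg : DifferentiableAt ℝ g x)
    (h0 : g x ≠ 0) : DifferentiableAt ℝ (fun y => f y / g y) x := by
  simp only [div_eq_mul_inv]
  exact hf.mul (hg.inv h0)

lemma pd_div (hf : DifferentiableAt ℝ f x) (hg : DifferentiableAt ℝ g x) (h0 : g x ≠ 0) :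
    pd i (fun y => f y / g y) x = (pd i f x * g x - f x * pd i g x) / g x ^ 2 := by
  have hz : pd i (fun y => f y / g y * g y) x = pd i f x := by
    have : (fun y => f y / g y * g y) =ᶠ[nhds x] f := by
      filter_upwards [hg.continuousAt.eventually_ne h0] with y hy
      field_simp
    simp [pd, this.fderiv_eq]
  rw [pd_mul (differentiableAt_div hf hg h0) hg] at hz
  rw [← hz]; field_simp; ring

lemma pd_sum {ι : Type*} (s : Finset ι) {F : ι → (Fin 4 → ℝ) → ℝ}
    (hF : ∀ a ∈ s, DifferentiableAt ℝ (F a) x) :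
    pd i (fun y => ∑ a ∈ s, F a y) x = ∑ a ∈ s, pd i (F a) x := by
  simp [pd, fderiv_fun_sum hF]

lemma contDiffOn_pd {U : Set (Fin 4 → ℝ)} (hU : IsOpen U) (hf : ContDiffOn ℝ 2 f U) :
    ContDiffOn ℝ 1 (pd i f) U := by
  have h := hf.fderiv_of_isOpen hU (m := 1) (by norm_num)
  exact h.clm_apply contDiffOn_const

end PartialDerivativeCalculus

/-- The physical entropy `s = log (p ρ^(−γ))`. -/
noncomputable def physEntropy (γ : ℝ) (ρ p : (Fin 4 → ℝ) → ℝ) (x : Fin 4 → ℝ) : ℝ :=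
  Real.log (p x * (ρ x) ^ (-γ))

section PhysicalEntropy

variable {γ : ℝ} {ρ p : (Fin 4 → ℝ) → ℝ} {x : Fin 4 → ℝ}

lemma hasFDerivAt_physEntropy (hρ : DifferentiableAt ℝ ρ x) (hp : DifferentiableAt ℝ p x)
    (hρ0 : 0 < ρ x) (hp0 : 0 < p x) :
    HasFDerivAt (physEntropy γ ρ p)
      ((p x)⁻¹ • fderiv ℝ p x - γ • (ρ x)⁻¹ • fderiv ℝ ρ x) x := by
  have h := (hp.hasFDerivAt.log hp0.ne').sub ((hρ.hasFDerivAt.log hρ0.ne').const_smul γ)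
  refine h.congr_of_eventuallyEq ?_
  filter_upwards [hρ.continuousAt.eventually (lt_mem_nhds hρ0),
    hp.continuousAt.eventually (lt_mem_nhds hp0)] with y h1 h2
  simp [physEntropy, Real.log_mul h2.ne' (Real.rpow_pos_of_pos h1 _).ne', Real.log_rpow h1]
  ring

lemma pd_physEntropy {i : Fin 4} (hρ : DifferentiableAt ℝ ρ x) (hp : DifferentiableAt ℝ p x)
    (hρ0 : 0 < ρ x) (hp0 : 0 < p x) :
    pd i (physEntropy γ ρ p) x = pd i p x / p x - γ * (pd i ρ x / ρ x) := by
  simp [pd, (hasFDerivAt_physEntropy hρ hp hρ0 hp0).fderiv]; ring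

end PhysicalEntropy

section Fluxes

variable {γ μ η κ R c_h : ℝ} {ρ p ψ : (Fin 4 → ℝ) → ℝ} {v B : Fin 3 → (Fin 4 → ℝ) → ℝ}
  {x : Fin 4 → ℝ}

lemma differentiableAt_entWP (hρ : DifferentiableAt ℝ ρ x) (hp : DifferentiableAt ℝ p x)
    (hψ : DifferentiableAt ℝ ψ x) (hv : ∀ k, DifferentiableAt ℝ (v k) x)
    (hB : ∀ k, DifferentiableAt ℝ (B k) x) (hρ0 : 0 < ρ x) (hp0 : 0 < p x) (a : Fin 9) :
    DifferentiableAt ℝ (fun y => entWP γ ρ p ψ v B y a) x := by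
  have hs := (hasFDerivAt_physEntropy (γ := γ) hρ hp hρ0 hp0).differentiableAt
  have hβ : DifferentiableAt ℝ (fun y => ρ y / (2 * p y)) x :=
    differentiableAt_div hρ (hp.const_mul 2) (by positivity)
  change DifferentiableAt ℝ (fun y => Real.log (p y * (ρ y) ^ (-γ))) x at hs
  fin_cases a <;>
    simp only [entWP, Fin.zero_eta, Fin.mk_one, Fin.reduceFinMk, Matrix.cons_val] <;> fun_prop

lemma differentiableAt_fviscP {U : Set (Fin 4 → ℝ)} (hU : IsOpen U)
    (hρ : ContDiffOn ℝ 2 ρ U) (hp : ContDiffOn ℝ 2 p U)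
    (hv : ∀ k, ContDiffOn ℝ 2 (v k) U) (hB : ∀ k, ContDiffOn ℝ 2 (B k) U)
    (hρ0 : ∀ y ∈ U, ρ y ≠ 0) (hx : x ∈ U) (d : Fin 3) (a : Fin 9) :
    DifferentiableAt ℝ (fun y => fviscP μ η κ R ρ p v B d y a) x := by
  have hUx := hU.mem_nhds hx
  have diff_spd : ∀ {f : (Fin 4 → ℝ) → ℝ}, ContDiffOn ℝ 2 f U → ∀ e,
      DifferentiableAt ℝ (fun y => spd e f y) x := fun hf e =>
    ((contDiffOn_pd hU hf).contDiffAt hUx).differentiableAt (by norm_num)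
  have hvd := fun k => ((hv k).contDiffAt hUx).differentiableAt (by norm_num)
  have hBd := fun k => ((hB k).contDiffAt hUx).differentiableAt (by norm_num)
  have hT := diff_spd (hp.div hρ hρ0) d
  have hgv := fun k e => diff_spd (hv k) e
  have hgB := fun k e => diff_spd (hB k) e
  change DifferentiableAt ℝ (fun y => spd d (fun y => p y / ρ y) y) x at hT
  fin_cases a <;>
    simp only [fviscP, Fin.zero_eta, Fin.mk_one, Fin.reduceFinMk, Matrix.cons_val] <;> fun_prop

/-- Contraction of `∂u` with the entropy variables is `∂S`. -/
lemma sum_entWP_mul_pd_consVar (hγ : 1 < γ) (hρ : DifferentiableAt ℝ ρ x)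
    (hp : DifferentiableAt ℝ p x) (hψ : DifferentiableAt ℝ ψ x)
    (hv : ∀ k, DifferentiableAt ℝ (v k) x) (hB : ∀ k, DifferentiableAt ℝ (B k) x)
    (hρ0 : 0 < ρ x) (hp0 : 0 < p x) (i : Fin 4) :
    ∑ a, entWP γ ρ p ψ v B x a * pd i (fun y => consVar γ ρ p ψ v B y a) x
      = pd i (entSP γ ρ p) x := by
  have hs := (hasFDerivAt_physEntropy (γ := γ) hρ hp hρ0 hp0).differentiableAt
  have hS : entSP γ ρ p = fun y => -(ρ y * physEntropy γ ρ p y) / (γ - 1) := rfl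
  have hsx : Real.log (p x * ρ x ^ (-γ)) = physEntropy γ ρ p x := rfl
  have h1 : γ - 1 ≠ 0 := by linarith
  simp only [hS, Fin.sum_univ_succ, Fin.sum_univ_zero, entWP, consVar, hsx]
  simp (disch := fun_prop) only [Fin.isValue, Matrix.cons_val, Fin.succ_zero_eq_one,
    Fin.succ_one_eq_two, Fin.reduceSucc, add_zero, pd_add, pd_neg, pd_mul, pd_const,
    pd_div_const, pd_sq, pd_physEntropy hρ hp hρ0 hp0]
  field_simp
  ring

/-- The entropy flux in direction `d` is `v_d S`, up to the contribution of the Janhunen term. -/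
lemma sum_entWP_mul_spd_fadvP (hγ : 1 < γ) (hρ : DifferentiableAt ℝ ρ x)
    (hp : DifferentiableAt ℝ p x) (hψ : DifferentiableAt ℝ ψ x)
    (hv : ∀ k, DifferentiableAt ℝ (v k) x) (hB : ∀ k, DifferentiableAt ℝ (B k) x)
    (hρ0 : 0 < ρ x) (hp0 : 0 < p x) (d : Fin 3) :
    ∑ a, entWP γ ρ p ψ v B x a * (spd d (fun y => fadvP γ c_h ρ p ψ v B d y a) x
        + (![0, 0, 0, 0, 0, v 0 x, v 1 x, v 2 x, 0] : Fin 9 → ℝ) a * spd d (B d) x)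
      = spd d (fun y => v d y * entSP γ ρ p y) x := by
  have hs := (hasFDerivAt_physEntropy (γ := γ) hρ hp hρ0 hp0).differentiableAt
  have hS : ∀ y, entSP γ ρ p y = -(ρ y * physEntropy γ ρ p y) / (γ - 1) := fun _ => rfl
  have hsx : Real.log (p x * ρ x ^ (-γ)) = physEntropy γ ρ p x := rfl
  have h1 : γ - 1 ≠ 0 := by linarith
  simp only [hS, Fin.sum_univ_succ, Fin.sum_univ_zero, entWP, fadvP, hsx, spd]
  generalize sp d = i
  fin_cases d <;>
  · simp (disch := fun_prop) [pd_add, pd_sub, pd_neg, pd_mul, pd_const,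
      pd_div_const, pd_sq, pd_physEntropy hρ hp hρ0 hp0]
    field_simp
    ring

/-- The viscous entropy production is nonnegative. -/
lemma sum_spd_entWP_mul_fviscP_nonneg (hμ : 0 < μ) (hη : 0 < η) (hκ : 0 < κ) (hR : 0 < R)
    (hρ : DifferentiableAt ℝ ρ x) (hp : DifferentiableAt ℝ p x)
    (hv : ∀ k, DifferentiableAt ℝ (v k) x) (hB : ∀ k, DifferentiableAt ℝ (B k) x)
    (hρ0 : 0 < ρ x) (hp0 : 0 < p x) :
    0 ≤ ∑ d, ∑ a, spd d (fun y => entWP γ ρ p ψ v B y a) x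
      * fviscP μ η κ R ρ p v B d x a := by
  have h2p : (2 : ℝ) * p x ≠ 0 := by positivity
  have hβ : DifferentiableAt ℝ (fun y => ρ y / (2 * p y)) x := differentiableAt_div hρ (hp.const_mul 2) h2p
  have hT : ∀ d, spd d (fun y => p y / ρ y) x
      = -2 * (p x / ρ x) ^ 2 * spd d (fun y => ρ y / (2 * p y)) x := fun d => by
    simp only [spd]
    rw [pd_div hp hρ hρ0.ne', pd_div hρ (hp.const_mul 2) h2p,
      pd_mul (differentiableAt_const _) hp, pd_const]
    field_simp
    ring
  have key : ∑ d, ∑ a, spd d (fun y => entWP γ ρ p ψ v B y a) x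
        * fviscP μ η κ R ρ p v B d x a
      = (ρ x / (2 * p x)) * (μ * (∑ i, ∑ j, (spd j (v i) x + spd i (v j) x) ^ 2
            - (4/3) * (∑ k, spd k (v k) x) ^ 2)
          + η * ∑ i, ∑ j, (spd j (B i) x - spd i (B j) x) ^ 2)
        + 4 * (κ / R) * (p x / ρ x) ^ 2
            * ∑ d, (spd d (fun y => ρ y / (2 * p y)) x) ^ 2 := by
    simp only [fviscP, hT, Fin.sum_univ_three]
    simp only [Fin.sum_univ_succ, Fin.sum_univ_zero, entWP, spd]
    have hval : ∀ y, ρ y / (2 * p y) = (fun y => ρ y / (2 * p y)) y := fun _ => rfl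
    generalize (fun y => ρ y / (2 * p y)) = β at *
    simp only [hval]
    simp (disch := fun_prop) [pd_neg, pd_mul, pd_const]
    ring
  rw [key]
  have hτ : 0 ≤ ∑ i, ∑ j, (spd j (v i) x + spd i (v j) x) ^ 2
      - (4/3) * (∑ k, spd k (v k) x) ^ 2 := by
    simp only [Fin.sum_univ_three]
    nlinarith [sq_nonneg (spd 0 (v 0) x - spd 1 (v 1) x),
      sq_nonneg (spd 0 (v 0) x - spd 2 (v 2) x), sq_nonneg (spd 1 (v 1) x - spd 2 (v 2) x),
      sq_nonneg (spd 1 (v 0) x + spd 0 (v 1) x), sq_nonneg (spd 2 (v 0) x + spd 0 (v 2) x),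
      sq_nonneg (spd 2 (v 1) x + spd 1 (v 2) x)]
  positivity

end Fluxes

/-- **Pointwise entropy dissipation identity for the resistive GLM-MHD equations.**
If the conserved variables satisfy `∂ₜu + ∇·f^a − ∇·fᵛ + φ(∇·B) = r` pointwise on an
open set with `ρ, p > 0`, then `∂ₜS + ∇·(vS) − ∇·Θ = −Σ_d (∂_d w)ᵀ f_dᵛ − 2αβψ²`,
where `Θ_d = wᵀ f_dᵛ`, and the right-hand side is nonpositive. -/
theorem resistive_glm_mhd_pointwise_entropy
    (γ μ η κ R c_h α : ℝ)
    (hγ : 1 < γ) (hμ : 0 < μ) (hη : 0 < η) (hκ : 0 < κ) (hR : 0 < R) (hα : 0 ≤ α)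
    (U : Set (Fin 4 → ℝ)) (hU : IsOpen U)
    (ρ p ψ : (Fin 4 → ℝ) → ℝ) (v B : Fin 3 → (Fin 4 → ℝ) → ℝ)
    (hρreg : ContDiffOn ℝ 2 ρ U) (hpreg : ContDiffOn ℝ 2 p U)
    (hψreg : ContDiffOn ℝ 2 ψ U)
    (hvreg : ∀ k, ContDiffOn ℝ 2 (v k) U) (hBreg : ∀ k, ContDiffOn ℝ 2 (B k) U)
    (hpos : ∀ x ∈ U, 0 < ρ x ∧ 0 < p x)
    (hPDE : ∀ x ∈ U, ∀ a : Fin 9,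
      pd 0 (fun y => consVar γ ρ p ψ v B y a) x
        + (∑ d, spd d (fun y => fadvP γ c_h ρ p ψ v B d y a) x)
        - (∑ d, spd d (fun y => fviscP μ η κ R ρ p v B d y a) x)
        + (![0, 0, 0, 0, 0, v 0 x, v 1 x, v 2 x, 0] : Fin 9 → ℝ) a
            * (∑ d, spd d (B d) x)
      = (![0, 0, 0, 0, 0, 0, 0, 0, -(α * ψ x)] : Fin 9 → ℝ) a) :
    ∀ x ∈ U,
      (pd 0 (entSP γ ρ p) x
          + (∑ d, spd d (fun y => v d y * entSP γ ρ p y) x)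
          - (∑ d, spd d
              (fun y => ∑ a, entWP γ ρ p ψ v B y a * fviscP μ η κ R ρ p v B d y a) x)
        = -(∑ d, ∑ a, spd d (fun y => entWP γ ρ p ψ v B y a) x
              * fviscP μ η κ R ρ p v B d x a)
          - 2 * α * (ρ x / (2 * p x)) * (ψ x) ^ 2)
      ∧ (-(∑ d, ∑ a, spd d (fun y => entWP γ ρ p ψ v B y a) x
              * fviscP μ η κ R ρ p v B d x a)
          - 2 * α * (ρ x / (2 * p x)) * (ψ x) ^ 2 ≤ 0) := by
  intro x hx
  obtain ⟨hρ0, hp0⟩ := hpos x hx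
  have hUx := hU.mem_nhds hx
  have hρ := (hρreg.contDiffAt hUx).differentiableAt (by norm_num)
  have hp := (hpreg.contDiffAt hUx).differentiableAt (by norm_num)
  have hψ := (hψreg.contDiffAt hUx).differentiableAt (by norm_num)
  have hv := fun k => ((hvreg k).contDiffAt hUx).differentiableAt (by norm_num)
  have hB := fun k => ((hBreg k).contDiffAt hUx).differentiableAt (by norm_num)
  have hw := differentiableAt_entWP (γ := γ) hρ hp hψ hv hB hρ0 hp0
  have hf := differentiableAt_fviscP (μ := μ) (η := η) (κ := κ) (R := R) hU hρreg hpreg hvreg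
    hBreg (fun y hy => (hpos y hy).1.ne') hx
  constructor
  · have hΘ : ∀ d, spd d
        (fun y => ∑ a, entWP γ ρ p ψ v B y a * fviscP μ η κ R ρ p v B d y a) x
        = ∑ a, spd d (fun y => entWP γ ρ p ψ v B y a) x * fviscP μ η κ R ρ p v B d x a
          + ∑ a, entWP γ ρ p ψ v B x a
              * spd d (fun y => fviscP μ η κ R ρ p v B d y a) x := fun d => by
      simp only [spd]
      rw [pd_sum _ fun a _ => (hw a).fun_mul (hf d a), ← Finset.sum_add_distrib]
      exact Finset.sum_congr rfl fun a _ => pd_mul (hw a) (hf d a)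
    have hbalance := Finset.sum_congr rfl
      fun a (_ : a ∈ Finset.univ) => congrArg (entWP γ ρ p ψ v B x a * ·) (hPDE x hx a)
    have hsource : ∑ a, entWP γ ρ p ψ v B x a
        * (![0, 0, 0, 0, 0, 0, 0, 0, -(α * ψ x)] : Fin 9 → ℝ) a
        = -(2 * α * (ρ x / (2 * p x)) * (ψ x) ^ 2) := by
      simp [Fin.sum_univ_succ, entWP]
      ring
    have hadv := Finset.sum_congr rfl fun d (_ : d ∈ Finset.univ) =>
      sum_entWP_mul_spd_fadvP (c_h := c_h) hγ hρ hp hψ hv hB hρ0 hp0 d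
    have htime := sum_entWP_mul_pd_consVar hγ hρ hp hψ hv hB hρ0 hp0 0
    rw [hsource] at hbalance
    simp only [hΘ, ← hadv, ← htime, Finset.sum_add_distrib]
    simp only [mul_add, mul_sub, Finset.sum_add_distrib, Finset.sum_sub_distrib,
      Finset.mul_sum] at hbalance ⊢
    rw [Finset.sum_comm (s := (Finset.univ : Finset (Fin 3))) (t := (Finset.univ : Finset (Fin 9)))
        (f := fun d a => entWP γ ρ p ψ v B x a * spd d (fun y => fadvP γ c_h ρ p ψ v B d y a) x),
      Finset.sum_comm (s := (Finset.univ : Finset (Fin 3))) (t := (Finset.univ : Finset (Fin 9)))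
        (f := fun d a => entWP γ ρ p ψ v B x a
          * ((![0, 0, 0, 0, 0, v 0 x, v 1 x, v 2 x, 0] : Fin 9 → ℝ) a * spd d (B d) x)),
      Finset.sum_comm (s := (Finset.univ : Finset (Fin 3))) (t := (Finset.univ : Finset (Fin 9)))
        (f := fun d a => entWP γ ρ p ψ v B x a
          * spd d (fun y => fviscP μ η κ R ρ p v B d y a) x)]
    linarith
  · have hvisc := sum_spd_entWP_mul_fviscP_nonneg (γ := γ) (ψ := ψ) hμ hη hκ hR hρ hp hv hB hρ0 hp0
    have : 0 ≤ 2 * α * (ρ x / (2 * p x)) * (ψ x) ^ 2 := by positivity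
    linarith
end

section
/- (Discrete entropy stability of the DGSEM for the resistive GLM-MHD equations, Theorem 4.7.) Fix γ > 1, μ, η, κ, R > 0, c_h ∈ ℝ, α ≥ 0 and Δx > 0; set J := Δx²/4. Let (ω, D, Q) be an SBP operator, and consider a uniform K₁ × K₂ Cartesian mesh of square elements of side Δx indexed by e ∈ (ℤ/K₁ℤ) × (ℤ/K₂ℤ) with fully periodic coupling. For d = 1, 2 let F_d^{ec} be symmetric two-point fluxes on admissible GLM-MHD states that are consistent (F_d^{ec}(U, U) = f_d^a(U)) and satisfy, for every pair of admissible states, ⟦w⟧ᵀ F_d^{ec} = ⟦Ψ_d⟧ − {B_d}·⟦Φ⟧, where Ψ_d := wᵀ f_d^a − v_d S + Φ B_d and Φ := 2β(v·B). Suppose nodal states U^e_{ij}(t) ∈ ℝ⁹ (0 ≤ i, j ≤ N), admissible (ρ > 0, p > 0) and differentiable in t, solve the semi-discrete split-form DGSEM: (i) the auxiliary gradient Q^e = (Q¹, Q²) is the BR1 discrete gradient of the nodal entropy variables W := w(U), defined nodewise by J·Q¹_{ij} = (Δx/2)[ Σ_m D_{im} W_{mj} + δ_{iN}(1/ω_N)({W}_{E,j}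 − W_{Nj}) + δ_{i0}(1/ω₀)(W_{0j} − {W}_{W,j}) ] and analogously for Q² in the j index, where {W} denotes the arithmetic average of the two nodal values of W across the corresponding element interface (east/west resp. north/south), with periodic neighbors; (ii) the viscous nodal flux is Fᵛ := K(U)·Q^e with K(U) the symmetric positive semi-definite matrix of Lemma 2.1 representing the viscous flux in terms of entropy-variable gradients; (iii) the evolution is J·(dU_{ij}/dt) = (Δx/2)·{ −2Σ_m D_{im} F₁^{ec}(U_{ij}, U_{mj}) − 2Σ_m D_{jm} F₂^{ec}(U_{ij}, U_{im}) + Σ_m D_{im} (F₁ᵛ)_{mj} + Σ_m D_{jm} (F₂ᵛ)_{im} − φ_{ij}[ Σ_m D_{im} (B₁)_{mj} + Σ_m D_{jm} (B₂)_{im} ] } + (Δx/2)·(boundary-node penalties): at each boundary node of each element edge, with outward normal sign ±1 and weight 1/ω₀ or 1/ω_N, subtract ±(1/ω)·[ F_d^{ec}(U_{node}, U_{neighbor node}) − f_d^a(U_{node}) ], add ±(1/ω)·[ {F_dᵛ} − (F_dᵛ)_{node} ] where {F_dᵛ} is the arithmetic average of the viscous nodal fluxes across the interface (BR1), and subtract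 ±(1/ω)·φ_{node}·[ {B_d} − (B_d)_{node} ] (the nonconservative surface term B*·n = φ^{interior}{B·n}); plus the damping source J·r(U_{ij}) with r = (0, …, 0, −αψ) and φ the Janhunen vector (0,0,0,0,0,v₁,v₂,v₃,0) evaluated at the node. Then the total discrete entropy S̄(t) := Σ_e J Σ_{i,j=0}^{N} ω_i ω_j S(U^e_{ij}(t)) is nonincreasing: dS̄/dt ≤ 0. -/
open Matrix

/-! Primitive quantities recovered from the conserved GLM-MHD variables
`u = (ρ, ρv, E, B, ψ) ∈ ℝ⁹`. -/

/-- Velocity recovered from the conserved variables. -/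
noncomputable def Vel (u : Fin 9 → ℝ) : Fin 3 → ℝ := ![u 1 / u 0, u 2 / u 0, u 3 / u 0]

/-- Magnetic field components of the conserved variables. -/
noncomputable def Mag (u : Fin 9 → ℝ) : Fin 3 → ℝ := ![u 5, u 6, u 7]

/-- Pressure recovered from the conserved variables,
`p = (γ−1)(E − ½ρ‖v‖² − ½‖B‖² − ½ψ²)`. -/
noncomputable def Pres (γ : ℝ) (u : Fin 9 → ℝ) : ℝ :=
  (γ - 1) * (u 4 - (1/2) * u 0 * (∑ k, (Vel u k) ^ 2)
    - (1/2) * (∑ k, (Mag u k) ^ 2) - (1/2) * (u 8) ^ 2)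

/-- `β = ρ/(2p)`. -/
noncomputable def Beta (γ : ℝ) (u : Fin 9 → ℝ) : ℝ := u 0 / (2 * Pres γ u)

/-- The entropy function `S = −ρs/(γ−1)` with `s = log (p ρ^(−γ))`. -/
noncomputable def entS (γ : ℝ) (u : Fin 9 → ℝ) : ℝ :=
  -(u 0 * Real.log (Pres γ u * (u 0) ^ (-γ))) / (γ - 1)

/-- The entropy variables `w`. -/
noncomputable def entW (γ : ℝ) (u : Fin 9 → ℝ) : Fin 9 → ℝ :=
  ![(γ - Real.log (Pres γ u * (u 0) ^ (-γ))) / (γ - 1)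
      - Beta γ u * ∑ k, (Vel u k) ^ 2,
    2 * Beta γ u * Vel u 0, 2 * Beta γ u * Vel u 1, 2 * Beta γ u * Vel u 2,
    -(2 * Beta γ u),
    2 * Beta γ u * Mag u 0, 2 * Beta γ u * Mag u 1, 2 * Beta γ u * Mag u 2,
    2 * Beta γ u * u 8]

/-- The advective GLM-MHD flux `f^a_d` in spatial direction `d` with GLM wave
speed `c_h`, as a function of the conserved variables. -/
noncomputable def Fadv (γ c_h : ℝ) (u : Fin 9 → ℝ) (d : Fin 3) : Fin 9 → ℝ :=
  ![u 0 * Vel u d,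
    u 0 * Vel u 0 * Vel u d + (Pres γ u + (1/2) * ∑ k, (Mag u k) ^ 2)
      * (if (0 : Fin 3) = d then 1 else 0) - Mag u 0 * Mag u d,
    u 0 * Vel u 1 * Vel u d + (Pres γ u + (1/2) * ∑ k, (Mag u k) ^ 2)
      * (if (1 : Fin 3) = d then 1 else 0) - Mag u 1 * Mag u d,
    u 0 * Vel u 2 * Vel u d + (Pres γ u + (1/2) * ∑ k, (Mag u k) ^ 2)
      * (if (2 : Fin 3) = d then 1 else 0) - Mag u 2 * Mag u d,
    Vel u d * ((1/2) * u 0 * (∑ k, (Vel u k) ^ 2) + γ * Pres γ u / (γ - 1)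
        + ∑ k, (Mag u k) ^ 2)
      - Mag u d * (∑ k, Vel u k * Mag u k) + c_h * u 8 * Mag u d,
    Vel u d * Mag u 0 - Mag u d * Vel u 0 + c_h * u 8 * (if d = 0 then 1 else 0),
    Vel u d * Mag u 1 - Mag u d * Vel u 1 + c_h * u 8 * (if d = 1 then 1 else 0),
    Vel u d * Mag u 2 - Mag u d * Vel u 2 + c_h * u 8 * (if d = 2 then 1 else 0),
    c_h * Mag u d]

/-- The contracted Janhunen nonconservative term `Φ = 2β(v·B)`. -/
noncomputable def Phi (γ : ℝ) (u : Fin 9 → ℝ) : ℝ :=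
  2 * Beta γ u * ∑ k, Vel u k * Mag u k

/-- The entropy flux potential `Ψ_d = wᵀ f_d^a − v_d S + Φ B_d`. -/
noncomputable def Psi (γ c_h : ℝ) (u : Fin 9 → ℝ) (d : Fin 3) : ℝ :=
  (∑ a, entW γ u a * Fadv γ c_h u d a) - Vel u d * entS γ u + Phi γ u * Mag u d

/-- The Janhunen nonconservative vector `φ = (0,0,0,0,0,v₁,v₂,v₃,0)`. -/
noncomputable def JanPhi (u : Fin 9 → ℝ) : Fin 9 → ℝ :=
  ![0, 0, 0, 0, 0, Vel u 0, Vel u 1, Vel u 2, 0]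

/-- The viscous flux of Lemma 2.1 in terms of a triple `g` of entropy-variable
gradients; the linear map `g ↦ Fvisc γ μ η κ R u g` is represented by the
symmetric positive semi-definite matrix `K(U)` of Lemma 2.1. -/
noncomputable def Fvisc (γ μ η κ R : ℝ) (u : Fin 9 → ℝ)
    (g : Fin 3 → Fin 9 → ℝ) (d : Fin 3) : Fin 9 → ℝ :=
  let w := entW γ u
  let v := Vel u
  let Bf := Mag u
  let gv : Fin 3 → Fin 3 → ℝ := fun k e =>
    -(1 / w 4) * (![g e 1, g e 2, g e 3] k) + ((![w 1, w 2, w 3] k) / (w 4) ^ 2) * g e 4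
  let gB : Fin 3 → Fin 3 → ℝ := fun k e =>
    -(1 / w 4) * (![g e 5, g e 6, g e 7] k) + ((![w 5, w 6, w 7] k) / (w 4) ^ 2) * g e 4
  let gT : Fin 3 → ℝ := fun e => (1 / (w 4) ^ 2) * g e 4
  let τ : Fin 3 → Fin 3 → ℝ := fun i j =>
    μ * (gv i j + gv j i) - (2/3) * μ * (∑ k, gv k k) * (if i = j then (1 : ℝ) else 0)
  ![0,
    τ 0 d, τ 1 d, τ 2 d,
    (∑ i, τ i d * v i) + (κ / R) * gT d + η * ∑ k, Bf k * (gB k d - gB d k),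
    η * (gB 0 d - gB d 0), η * (gB 1 d - gB d 1), η * (gB 2 d - gB d 2),
    0]

/-- The BR1 discrete gradient of the nodal entropy variables: the strong-form
derivative plus interface penalties using arithmetic averages of the entropy
variables across element interfaces (the third spatial direction is zero in 2D). -/
noncomputable def BR1grad (γ Δx : ℝ) (N : ℕ)
    (ω : Fin (N+1) → ℝ) (D : Matrix (Fin (N+1)) (Fin (N+1)) ℝ)
    {E : Type*} (Un : E → Fin (N+1) → Fin (N+1) → Fin 9 → ℝ)
    (east west north south : E → E)
    (e : E) (i j : Fin (N+1)) : Fin 3 → Fin 9 → ℝ :=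
  let J := Δx ^ 2 / 4
  let lastN : Fin (N+1) := Fin.last N
  let W := fun (e' : E) (i' j' : Fin (N+1)) => entW γ (Un e' i' j')
  ![fun a => (1/J) * (Δx/2) * ((∑ m, D i m * W e m j a)
      + (if i = lastN then (1 / ω lastN)
          * ((W e lastN j a + W (east e) 0 j a) / 2 - W e lastN j a) else 0)
      + (if i = 0 then (1 / ω 0)
          * (W e 0 j a - (W (west e) lastN j a + W e 0 j a) / 2) else 0)),
    fun a => (1/J) * (Δx/2) * ((∑ m, D j m * W e i m a)
      + (if j = lastN then (1 / ω lastN)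
          * ((W e i lastN a + W (north e) i 0 a) / 2 - W e i lastN a) else 0)
      + (if j = 0 then (1 / ω 0)
          * (W e i 0 a - (W (south e) i lastN a + W e i 0 a) / 2) else 0)),
    fun _ => 0]

/-- The nodal viscous flux `Fᵛ = K(U)·Qᵉ`, i.e. the viscous flux of Lemma 2.1
evaluated on the BR1 discrete gradient of the entropy variables. -/
noncomputable def FvNode (γ μ η κ R Δx : ℝ) (N : ℕ)
    (ω : Fin (N+1) → ℝ) (D : Matrix (Fin (N+1)) (Fin (N+1)) ℝ)
    {E : Type*} (Un : E → Fin (N+1) → Fin (N+1) → Fin 9 → ℝ)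
    (east west north south : E → E)
    (e : E) (i j : Fin (N+1)) (d : Fin 3) : Fin 9 → ℝ :=
  Fvisc γ μ η κ R (Un e i j) (BR1grad γ Δx N ω D Un east west north south e i j) d

/-- The right-hand side of the semi-discrete split-form DGSEM for the resistive
GLM-MHD equations: entropy-conservative split-form volume terms, viscous volume
terms, nonconservative volume terms, interface penalties (entropy-conservative
advective flux, BR1 viscous flux, and the nonconservative surface term
`B*·n = φ^{interior}{B·n}`), and the GLM damping source `r = (0,…,0,−αψ)`. -/
noncomputable def dgRHS (γ μ η κ R c_h α Δx : ℝ) (N : ℕ)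
    (ω : Fin (N+1) → ℝ) (D : Matrix (Fin (N+1)) (Fin (N+1)) ℝ)
    {E : Type*} (Un : E → Fin (N+1) → Fin (N+1) → Fin 9 → ℝ)
    (east west north south : E → E)
    (Fec : Fin 2 → (Fin 9 → ℝ) → (Fin 9 → ℝ) → Fin 9 → ℝ)
    (e : E) (i j : Fin (N+1)) : Fin 9 → ℝ :=
  let J := Δx ^ 2 / 4
  let lastN : Fin (N+1) := Fin.last N
  let u := Un e i j
  let Fv := FvNode γ μ η κ R Δx N ω D Un east west north south
  fun a =>
    (1/J) * ((Δx/2) * (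
        -(2 * ∑ m, D i m * Fec 0 u (Un e m j) a)
        - 2 * (∑ m, D j m * Fec 1 u (Un e i m) a)
        + (∑ m, D i m * Fv e m j 0 a)
        + (∑ m, D j m * Fv e i m 1 a)
        - JanPhi u a * ((∑ m, D i m * Mag (Un e m j) 0)
            + ∑ m, D j m * Mag (Un e i m) 1))
      + (Δx/2) * (
          (if i = lastN then (1 / ω lastN) * (
              -(Fec 0 u (Un (east e) 0 j) a - Fadv γ c_h u 0 a)
              + ((Fv e i j 0 a + Fv (east e) 0 j 0 a) / 2 - Fv e i j 0 a)
              - JanPhi u a * ((Mag u 0 + Mag (Un (east e) 0 j) 0) / 2 - Mag u 0))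
            else 0)
        + (if i = 0 then (1 / ω 0) * (
              (Fec 0 u (Un (west e) lastN j) a - Fadv γ c_h u 0 a)
              - ((Fv e i j 0 a + Fv (west e) lastN j 0 a) / 2 - Fv e i j 0 a)
              + JanPhi u a * ((Mag u 0 + Mag (Un (west e) lastN j) 0) / 2 - Mag u 0))
            else 0)
        + (if j = lastN then (1 / ω lastN) * (
              -(Fec 1 u (Un (north e) i 0) a - Fadv γ c_h u 1 a)
              + ((Fv e i j 1 a + Fv (north e) i 0 1 a) / 2 - Fv e i j 1 a)
              - JanPhi u a * ((Mag u 1 + Mag (Un (north e) i 0) 1) / 2 - Mag u 1))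
            else 0)
        + (if j = 0 then (1 / ω 0) * (
              (Fec 1 u (Un (south e) i lastN) a - Fadv γ c_h u 1 a)
              - ((Fv e i j 1 a + Fv (south e) i lastN 1 a) / 2 - Fv e i j 1 a)
              + JanPhi u a * ((Mag u 1 + Mag (Un (south e) i lastN) 1) / 2 - Mag u 1))
            else 0))
      + J * (![0, 0, 0, 0, 0, 0, 0, 0, -(α * u 8)] : Fin 9 → ℝ) a)

/-- Summation by parts for a bilinear nodal quantity. -/
theorem sbp_sum_add_swap {N : ℕ} (hN : 1 ≤ N) {ω : Fin (N+1) → ℝ}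
    {D : Matrix (Fin (N+1)) (Fin (N+1)) ℝ}
    (hSBP : Matrix.diagonal ω * D + (Matrix.diagonal ω * D)ᵀ
      = Matrix.diagonal (fun i => if i = 0 then (-1 : ℝ)
          else if i = Fin.last N then 1 else 0))
    (X : Fin (N+1) → Fin (N+1) → ℝ) :
    ∑ i, ∑ m, ω i * D i m * (X i m + X m i)
      = X (Fin.last N) (Fin.last N) - X 0 0 := by
  have hentry : ∀ i m, ω i * D i m + ω m * D m i
      = if i = m then (if i = 0 then (-1 : ℝ) else if i = Fin.last N then 1 else 0) else 0 := by
    intro i m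
    have h := congrFun (congrFun hSBP i) m
    simpa [Matrix.diagonal_apply, mul_comm] using h
  have hne : Fin.last N ≠ 0 := by
    intro h
    have := congrArg Fin.val h
    simp at this
    omega
  have hswap : ∑ i, ∑ m, ω i * D i m * X m i = ∑ i, ∑ m, ω m * D m i * X i m :=
    Finset.sum_comm
  calc ∑ i, ∑ m, ω i * D i m * (X i m + X m i)
      = ∑ i, ∑ m, (ω i * D i m + ω m * D m i) * X i m := by
        simp only [mul_add, add_mul, Finset.sum_add_distrib, hswap]
    _ = ∑ i, (if i = 0 then (-1 : ℝ) else if i = Fin.last N then 1 else 0) * X i i := by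
        simp [hentry, ite_mul]
    _ = ∑ i, ((if i = Fin.last N then X i i else 0) - (if i = 0 then X i i else 0)) := by
        refine Finset.sum_congr rfl fun i _ => ?_
        by_cases h0 : i = 0
        · simp [h0, hne.symm]
        · simp [h0]
    _ = X (Fin.last N) (Fin.last N) - X 0 0 := by
        simp [Finset.sum_sub_distrib]

/-- Quadrature against boundary penalties scaled by the inverse weights. -/
theorem sum_weight_mul_boundary {N : ℕ} {ω : Fin (N+1) → ℝ} (hω : ∀ i, 0 < ω i)
    (V P M : Fin (N+1) → ℝ) :
    ∑ i, ω i * (V i + (if i = Fin.last N then 1 / ω (Fin.last N) * P i else 0)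
        + (if i = 0 then 1 / ω 0 * M i else 0))
      = (∑ i, ω i * V i) + P (Fin.last N) + M 0 := by
  have h : ∀ i, ω i * (V i + (if i = Fin.last N then 1 / ω (Fin.last N) * P i else 0)
        + (if i = 0 then 1 / ω 0 * M i else 0))
      = ω i * V i + (if i = Fin.last N then P i else 0) + (if i = 0 then M i else 0) := by
    intro i
    have hi := (hω i).ne'
    have h0 := (hω 0).ne'
    have hl := (hω (Fin.last N)).ne'
    rw [mul_add, mul_add]
    congr 1
    · congr 1
      split_ifs with h
      · subst h; field_simp
      · simp
    · split_ifs with h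
      · subst h; field_simp
      · simp
  rw [Finset.sum_congr rfl fun i _ => h i]
  simp [Finset.sum_add_distrib]

/-- Entropy conservation of the split-form advective and nonconservative terms along a
periodic family of lines.  Here `A e i e' i'` is the contraction of the entropy variables at
the node `(e, i)` with the two-point flux between `(e, i)` and `(e', i')`. -/
theorem sum_advective_line_eq_zero {N : ℕ} (hN : 1 ≤ N) {ω : Fin (N+1) → ℝ}
    (hω : ∀ i, 0 < ω i) {D : Matrix (Fin (N+1)) (Fin (N+1)) ℝ}
    (hrows : ∀ i, (∑ m, D i m) = 0)
    (hSBP : Matrix.diagonal ω * D + (Matrix.diagonal ω * D)ᵀ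
      = Matrix.diagonal (fun i => if i = 0 then (-1 : ℝ)
          else if i = Fin.last N then 1 else 0))
    {E : Type*} [Fintype E] (σ : E ≃ E)
    (A : E → Fin (N+1) → E → Fin (N+1) → ℝ) (b Ψ Φ : E → Fin (N+1) → ℝ)
    (hA : ∀ e i e' i', A e' i' e i - A e i e' i'
      = (Ψ e' i' - Ψ e i) - ((b e i + b e' i') / 2) * (Φ e' i' - Φ e i)) :
    ∑ e, ∑ i, ω i * ((-(2 * ∑ m, D i m * A e i e m) - Φ e i * ∑ m, D i m * b e m)
      + (if i = Fin.last N then 1 / ω (Fin.last N) *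
          (-(A e i (σ e) 0 - A e i e i)
            - Φ e i * ((b e i + b (σ e) 0) / 2 - b e i)) else 0)
      + (if i = 0 then 1 / ω 0 *
          ((A e i (σ.symm e) (Fin.last N) - A e i e i)
            + Φ e i * ((b e i + b (σ.symm e) (Fin.last N)) / 2 - b e i)) else 0)) = 0 := by
  have hvol : ∀ e, ∑ i, ω i * (-(2 * ∑ m, D i m * A e i e m) - Φ e i * ∑ m, D i m * b e m)
      = -((A e (Fin.last N) e (Fin.last N) - Ψ e (Fin.last N)
            + Φ e (Fin.last N) * b e (Fin.last N))
          - (A e 0 e 0 - Ψ e 0 + Φ e 0 * b e 0)) := by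
    intro e
    have h := sbp_sum_add_swap hN hSBP
      (fun i m => A e i e m - Ψ e i + (Φ e i * b e m + Φ e i * b e i) / 2)
    have hrow : ∑ i, ∑ m, ω i * D i m * (2 * Ψ e i - b e i * Φ e i) = 0 := by
      simp [← Finset.sum_mul, ← Finset.mul_sum, hrows]
    have hsum : ∑ i, ω i * (-(2 * ∑ m, D i m * A e i e m) - Φ e i * ∑ m, D i m * b e m)
        = -(∑ i, ∑ m, ω i * D i m *
            ((A e i e m - Ψ e i + (Φ e i * b e m + Φ e i * b e i) / 2)
              + (A e m e i - Ψ e m + (Φ e m * b e i + Φ e m * b e m) / 2)))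
          - ∑ i, ∑ m, ω i * D i m * (2 * Ψ e i - b e i * Φ e i) := by
      rw [← Finset.sum_neg_distrib, ← Finset.sum_sub_distrib]
      refine Finset.sum_congr rfl fun i _ => ?_
      rw [← Finset.sum_neg_distrib, ← Finset.sum_sub_distrib, Finset.mul_sum, Finset.mul_sum,
        ← Finset.sum_neg_distrib, ← Finset.sum_sub_distrib, Finset.mul_sum]
      refine Finset.sum_congr rfl fun m _ => ?_
      linear_combination ω i * D i m * hA e i e m
    rw [hsum, hrow, h]
    ring
  simp only [sum_weight_mul_boundary hω, hvol]
  have hre := Equiv.sum_comp σ (fun e => Ψ e 0 - A e 0 (σ.symm e) (Fin.last N)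
    - Φ e 0 * ((b e 0 + b (σ.symm e) (Fin.last N)) / 2))
  rw [← sub_eq_zero, ← Finset.sum_sub_distrib] at hre
  refine Eq.trans ?_ hre
  refine Finset.sum_congr rfl fun e _ => ?_
  simp only [Equiv.symm_apply_apply]
  linear_combination hA e (Fin.last N) (σ e) 0

/-- The BR1 derivative at the node `i` of a line with nodal values `f`, whose adjacent values on
the right and left neighbouring lines are `fR` and `fL` (reference coordinates). -/
noncomputable def br1Deriv {N : ℕ} (ω : Fin (N+1) → ℝ)
    (D : Matrix (Fin (N+1)) (Fin (N+1)) ℝ) (f : Fin (N+1) → ℝ) (fR fL : ℝ)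
    (i : Fin (N+1)) : ℝ :=
  (∑ m, D i m * f m)
    + (if i = Fin.last N then 1 / ω (Fin.last N) * ((f i + fR) / 2 - f i) else 0)
    + (if i = 0 then 1 / ω 0 * (f i - (fL + f i) / 2) else 0)

/-- Discrete integration by parts: the BR1 derivative is skew-adjoint along a periodic family of
lines. -/
theorem sum_mul_br1Deriv {N : ℕ} (hN : 1 ≤ N) {ω : Fin (N+1) → ℝ}
    (hω : ∀ i, 0 < ω i) {D : Matrix (Fin (N+1)) (Fin (N+1)) ℝ}
    (hSBP : Matrix.diagonal ω * D + (Matrix.diagonal ω * D)ᵀ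
      = Matrix.diagonal (fun i => if i = 0 then (-1 : ℝ)
          else if i = Fin.last N then 1 else 0))
    {E : Type*} [Fintype E] (σ : E ≃ E) (W F : E → Fin (N+1) → ℝ) :
    ∑ e, ∑ i, ω i * (W e i * br1Deriv ω D (F e) (F (σ e) 0) (F (σ.symm e) (Fin.last N)) i)
    = -∑ e, ∑ i, ω i *
        (F e i * br1Deriv ω D (W e) (W (σ e) 0) (W (σ.symm e) (Fin.last N)) i) := by
  have hdist : ∀ c V P M : Fin (N+1) → ℝ,
      ∑ i, ω i * (c i * (V i + (if i = Fin.last N then 1 / ω (Fin.last N) * P i else 0)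
        + (if i = 0 then 1 / ω 0 * M i else 0)))
      = (∑ i, ω i * (c i * V i)) + c (Fin.last N) * P (Fin.last N) + c 0 * M 0 := by
    intro c V P M
    rw [← sum_weight_mul_boundary hω (fun i => c i * V i) (fun i => c i * P i)
      (fun i => c i * M i)]
    refine Finset.sum_congr rfl fun i _ => ?_
    split_ifs <;> ring
  have hvol : ∀ e, (∑ i, ω i * (W e i * ∑ m, D i m * F e m))
      + (∑ i, ω i * (F e i * ∑ m, D i m * W e m))
      = W e (Fin.last N) * F e (Fin.last N) - W e 0 * F e 0 := by
    intro e
    rw [← sbp_sum_add_swap hN hSBP (fun i m => W e i * F e m), ← Finset.sum_add_distrib]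
    refine Finset.sum_congr rfl fun i _ => ?_
    simp only [Finset.mul_sum, ← Finset.sum_add_distrib]
    refine Finset.sum_congr rfl fun m _ => ?_
    ring
  simp only [br1Deriv, hdist]
  rw [← sub_eq_zero, sub_neg_eq_add, ← Finset.sum_add_distrib]
  have hre := Equiv.sum_comp σ (fun e => (W e 0 * F (σ.symm e) (Fin.last N)
    + F e 0 * W (σ.symm e) (Fin.last N)) / 2)
  rw [← sub_eq_zero, ← Finset.sum_sub_distrib] at hre
  refine Eq.trans ?_ hre
  refine Finset.sum_congr rfl fun e _ => ?_
  simp only [Equiv.symm_apply_apply]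
  linear_combination hvol e

/-- Chain rule: the entropy variables are the gradient of the entropy. -/
theorem hasDerivAt_entS {γ : ℝ} (hγ : 1 < γ) {f : ℝ → Fin 9 → ℝ} {f' : Fin 9 → ℝ} {t : ℝ}
    (hf : HasDerivAt f f' t) (hρ : 0 < f t 0) (hp : 0 < Pres γ (f t)) :
    HasDerivAt (fun τ => entS γ (f τ)) (∑ a, entW γ (f t) a * f' a) t := by
  have hc : ∀ a, HasDerivAt (fun τ => f τ a) (f' a) t := hasDerivAt_pi.1 hf
  have hρ' := hρ.ne'
  have hp' := hp.ne'
  have hγ' : γ - 1 ≠ 0 := by linarith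
  have hPeq : (fun τ => Pres γ (f τ)) = fun τ => (γ - 1) * (f τ 4
      - (1/2) * f τ 0 * ((f τ 1 / f τ 0) ^ 2 + (f τ 2 / f τ 0) ^ 2 + (f τ 3 / f τ 0) ^ 2)
      - (1/2) * ((f τ 5) ^ 2 + (f τ 6) ^ 2 + (f τ 7) ^ 2) - (1/2) * (f τ 8) ^ 2) := by
    funext τ
    simp [Pres, Vel, Mag, Fin.sum_univ_three]
  have hP : HasDerivAt (fun τ => Pres γ (f τ)) ((γ - 1) * (f' 4
      - (f t 1 / f t 0 * f' 1 + f t 2 / f t 0 * f' 2 + f t 3 / f t 0 * f' 3)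
      + (1/2) * ((f t 1 / f t 0) ^ 2 + (f t 2 / f t 0) ^ 2 + (f t 3 / f t 0) ^ 2) * f' 0
      - (f t 5 * f' 5 + f t 6 * f' 6 + f t 7 * f' 7) - f t 8 * f' 8)) t := by
    rw [hPeq]
    have hv : ∀ a, HasDerivAt (fun τ => (f τ a / f τ 0) ^ 2) _ t :=
      fun a => ((hc a).fun_div (hc 0) hρ').fun_pow 2
    have hsq : ∀ a, HasDerivAt (fun τ => (f τ a) ^ 2) _ t := fun a => (hc a).fun_pow 2
    refine (((((hc 4).fun_sub (((hc 0).const_mul (1/2)).fun_mul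
      (((hv 1).fun_add (hv 2)).fun_add (hv 3)))).fun_sub
      ((((hsq 5).fun_add (hsq 6)).fun_add (hsq 7)).const_mul (1/2))).fun_sub
      ((hsq 8).const_mul (1/2))).const_mul (γ - 1)).congr_deriv ?_
    push_cast
    field_simp
    ring
  have hS := (((hc 0).fun_mul ((hP.fun_mul ((hc 0).rpow_const (p := -γ) (Or.inl hρ'))).log
    (mul_ne_zero hp' (Real.rpow_pos_of_pos hρ _).ne'))).fun_neg).div_const (γ - 1)
  refine hS.congr_deriv ?_
  have hrp : f t 0 ^ (-γ - 1) = f t 0 ^ (-γ) / f t 0 := by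
    rw [Real.rpow_sub hρ, Real.rpow_one]
  have hr' := (Real.rpow_pos_of_pos hρ (-γ)).ne'
  rw [hrp]
  simp only [entW, Beta, Vel, Mag, Fin.sum_univ_succ]
  generalize Real.log (Pres γ (f t) * f t 0 ^ (-γ)) = L
  generalize Pres γ (f t) = p at *
  generalize f t 0 ^ (-γ) = r at *
  simp [Fin.succ]
  field_simp
  ring

/-- Positive semi-definiteness of the viscous flux as a linear map of the
entropy-variable gradients. -/
theorem sum_mul_Fvisc_nonneg {γ μ η κ R : ℝ} (hμ : 0 ≤ μ) (hη : 0 ≤ η) (hκ : 0 ≤ κ)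
    (hR : 0 ≤ R) {u : Fin 9 → ℝ} (hρ : 0 < u 0) (hp : 0 < Pres γ u)
    (g : Fin 3 → Fin 9 → ℝ) :
    0 ≤ ∑ d, ∑ a, Fvisc γ μ η κ R u g d a * g d a := by
  have hw : entW γ u 4 = -(u 0 / Pres γ u) := by
    simp [entW, Beta]
    field_simp
  have hc : 0 < u 0 / Pres γ u := div_pos hρ hp
  set c := u 0 / Pres γ u with hcdef
  have hv : ∀ k : Fin 3, ![entW γ u 1, entW γ u 2, entW γ u 3] k = c * Vel u k := by
    intro k
    fin_cases k <;> simp [entW, Beta, hcdef] <;> left <;> field_simp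
  have hB : ∀ k : Fin 3, ![entW γ u 5, entW γ u 6, entW γ u 7] k = c * Mag u k := by
    intro k
    fin_cases k <;> simp [entW, Beta, hcdef] <;> left <;> field_simp
  clear_value c
  let a : Fin 3 → Fin 3 → ℝ := fun k e =>
    c⁻¹ * ((![g e 1, g e 2, g e 3] k) + Vel u k * g e 4)
  let h : Fin 3 → Fin 3 → ℝ := fun k e =>
    c⁻¹ * ((![g e 5, g e 6, g e 7] k) + Mag u k * g e 4)
  have hsq : ∑ d, ∑ b, Fvisc γ μ η κ R u g d b * g d b
      = c * μ * ((a 0 1 + a 1 0) ^ 2 + (a 0 2 + a 2 0) ^ 2 + (a 1 2 + a 2 1) ^ 2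
          + (2/3) * ((a 0 0 - a 1 1) ^ 2 + (a 0 0 - a 2 2) ^ 2 + (a 1 1 - a 2 2) ^ 2))
        + c * η * ((h 0 1 - h 1 0) ^ 2 + (h 0 2 - h 2 0) ^ 2 + (h 1 2 - h 2 1) ^ 2)
        + (κ / R) * (c⁻¹) ^ 2 * (g 0 4 ^ 2 + g 1 4 ^ 2 + g 2 4 ^ 2) := by
    simp only [Fvisc, hw, hv, hB, a, h, Fin.sum_univ_succ]
    simp [Fin.succ]
    field_simp
    ring
  rw [hsq]
  positivity

/-- The entropy-conservative advective and nonconservative contribution to the semi-discrete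
scheme at the node `i` of a line with nodal states `u` in the direction `k`; `uR` and `uL` are
the adjacent states on the right and left neighbouring lines (reference coordinates). -/
noncomputable def advLine (γ c_h : ℝ) {N : ℕ} (ω : Fin (N+1) → ℝ)
    (D : Matrix (Fin (N+1)) (Fin (N+1)) ℝ)
    (F : (Fin 9 → ℝ) → (Fin 9 → ℝ) → Fin 9 → ℝ) (k : Fin 3)
    (u : Fin (N+1) → Fin 9 → ℝ) (uR uL : Fin 9 → ℝ) (i : Fin (N+1)) (a : Fin 9) : ℝ :=
  (-(2 * ∑ m, D i m * F (u i) (u m) a) - JanPhi (u i) a * ∑ m, D i m * Mag (u m) k)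
    + (if i = Fin.last N then 1 / ω (Fin.last N) *
        (-(F (u i) uR a - Fadv γ c_h (u i) k a)
          - JanPhi (u i) a * ((Mag (u i) k + Mag uR k) / 2 - Mag (u i) k)) else 0)
    + (if i = 0 then 1 / ω 0 *
        ((F (u i) uL a - Fadv γ c_h (u i) k a)
          + JanPhi (u i) a * ((Mag (u i) k + Mag uL k) / 2 - Mag (u i) k)) else 0)

theorem sum_entW_mul_JanPhi (γ : ℝ) (u : Fin 9 → ℝ) :
    ∑ a, entW γ u a * JanPhi u a = Phi γ u := by
  simp only [entW, JanPhi, Phi, Fin.sum_univ_succ]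
  simp [Fin.succ]
  ring

/-- The advective and nonconservative terms conserve the total entropy along a periodic family
of lines. -/
theorem sum_entW_mul_advLine {γ c_h : ℝ} {N : ℕ} (hN : 1 ≤ N) {ω : Fin (N+1) → ℝ}
    (hω : ∀ i, 0 < ω i) {D : Matrix (Fin (N+1)) (Fin (N+1)) ℝ}
    (hrows : ∀ i, (∑ m, D i m) = 0)
    (hSBP : Matrix.diagonal ω * D + (Matrix.diagonal ω * D)ᵀ
      = Matrix.diagonal (fun i => if i = 0 then (-1 : ℝ)
          else if i = Fin.last N then 1 else 0))
    {E : Type*} [Fintype E] (σ : E ≃ E)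
    {F : (Fin 9 → ℝ) → (Fin 9 → ℝ) → Fin 9 → ℝ} {k : Fin 3}
    (hFsym : ∀ u₁ u₂, F u₁ u₂ = F u₂ u₁)
    (hFcons : ∀ u : Fin 9 → ℝ, 0 < u 0 → 0 < Pres γ u → F u u = Fadv γ c_h u k)
    (hF : ∀ u₁ u₂ : Fin 9 → ℝ, 0 < u₁ 0 → 0 < Pres γ u₁ → 0 < u₂ 0 → 0 < Pres γ u₂ →
      (∑ a, (entW γ u₂ a - entW γ u₁ a) * F u₁ u₂ a)
        = (Psi γ c_h u₂ k - Psi γ c_h u₁ k)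
          - ((Mag u₁ k + Mag u₂ k) / 2) * (Phi γ u₂ - Phi γ u₁))
    (u : E → Fin (N+1) → Fin 9 → ℝ) (hu : ∀ e i, 0 < u e i 0 ∧ 0 < Pres γ (u e i)) :
    ∑ e, ∑ i, ω i * ∑ a, entW γ (u e i) a *
      advLine γ c_h ω D F k (u e) (u (σ e) 0) (u (σ.symm e) (Fin.last N)) i a = 0 := by
  have hA : ∀ e i e' i', (∑ a, entW γ (u e' i') a * F (u e' i') (u e i) a)
      - (∑ a, entW γ (u e i) a * F (u e i) (u e' i') a)
      = (Psi γ c_h (u e' i') k - Psi γ c_h (u e i) k)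
        - ((Mag (u e i) k + Mag (u e' i') k) / 2) * (Phi γ (u e' i') - Phi γ (u e i)) := by
    intro e i e' i'
    rw [← hF _ _ (hu e i).1 (hu e i).2 (hu e' i').1 (hu e' i').2, hFsym (u e' i') (u e i),
      ← Finset.sum_sub_distrib]
    exact Finset.sum_congr rfl fun a _ => by ring
  rw [← sum_advective_line_eq_zero hN hω hrows hSBP σ
    (fun e i e' i' => ∑ a, entW γ (u e i) a * F (u e i) (u e' i') a)
    (fun e i => Mag (u e i) k) (fun e i => Psi γ c_h (u e i) k) (fun e i => Phi γ (u e i)) hA]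
  refine Finset.sum_congr rfl fun e _ => Finset.sum_congr rfl fun i _ => ?_
  congr 1
  simp only [advLine, mul_add, Finset.sum_add_distrib, ← hFcons _ (hu e i).1 (hu e i).2,
    ← sum_entW_mul_JanPhi γ]
  congr 1
  · congr 1
    · simp only [mul_sub, Finset.sum_sub_distrib, Finset.sum_mul]
      congr 1
      · simp only [mul_neg, Finset.sum_neg_distrib, Finset.mul_sum]
        rw [Finset.sum_comm]
        congr 1
        exact Finset.sum_congr rfl fun m _ => Finset.sum_congr rfl fun a _ => by ring
      · exact Finset.sum_congr rfl fun a _ => by ring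
    · split_ifs
      · rw [← Finset.sum_sub_distrib, ← Finset.sum_neg_distrib, Finset.sum_mul,
          ← Finset.sum_sub_distrib, Finset.mul_sum]
        exact Finset.sum_congr rfl fun a _ => by ring
      · simp
  · split_ifs
    · rw [← mul_add, ← Finset.sum_sub_distrib, Finset.sum_mul,
        ← Finset.sum_add_distrib, Finset.mul_sum]
      exact Finset.sum_congr rfl fun a _ => by ring
    · simp

/-- Grouping a tensor-product quadrature by lines in the first direction. -/
theorem sum_lines_fst {E ι : Type*} [Fintype E] [Fintype ι] (ω : ι → ℝ) (X : E → ι → ι → ℝ) :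
    ∑ e, ∑ i, ∑ j, ω i * ω j * X e i j = ∑ j, ω j * ∑ e, ∑ i, ω i * X e i j := by
  simp only [Finset.mul_sum]
  rw [Finset.sum_comm (s := (Finset.univ : Finset ι))]
  refine Finset.sum_congr rfl fun e _ => ?_
  rw [Finset.sum_comm]
  exact Finset.sum_congr rfl fun j _ => Finset.sum_congr rfl fun i _ => by ring

/-- Grouping a tensor-product quadrature by lines in the second direction. -/
theorem sum_lines_snd {E ι : Type*} [Fintype E] [Fintype ι] (ω : ι → ℝ) (X : E → ι → ι → ℝ) :
    ∑ e, ∑ i, ∑ j, ω i * ω j * X e i j = ∑ i, ω i * ∑ e, ∑ j, ω j * X e i j := by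
  simp only [Finset.mul_sum]
  rw [Finset.sum_comm (s := (Finset.univ : Finset ι))]
  exact Finset.sum_congr rfl fun e _ => Finset.sum_congr rfl fun i _ =>
    Finset.sum_congr rfl fun j _ => by ring

theorem sum_weight_contract {E ι κ : Type*} [Fintype E] [Fintype ι] [Fintype κ] (ω : ι → ℝ)
    (X Y : E → ι → κ → ℝ) :
    ∑ e, ∑ i, ω i * ∑ a, X e i a * Y e i a = ∑ a, ∑ e, ∑ i, ω i * (X e i a * Y e i a) := by
  simp only [Finset.mul_sum]
  rw [Finset.sum_comm (s := (Finset.univ : Finset κ))]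
  exact Finset.sum_congr rfl fun e _ => Finset.sum_comm

/-- **Discrete entropy stability of the DGSEM for the resistive GLM-MHD
equations** (Theorem 4.7).  For the semi-discrete split-form DGSEM on a fully
periodic uniform Cartesian mesh, built on an SBP operator, entropy-conservative
two-point fluxes, BR1 viscous fluxes in terms of entropy-variable gradients, the
nonconservative surface term `B*·n = φ^{interior}{B·n}`, and the GLM damping
source, the total discrete entropy is nonincreasing in time. -/
theorem dgsem_resistive_glm_mhd_entropy_stable
    (γ μ η κ R c_h α Δx : ℝ)
    (hγ : 1 < γ) (hμ : 0 < μ) (hη : 0 < η) (hκ : 0 < κ) (hR : 0 < R)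
    (hα : 0 ≤ α) (hΔx : 0 < Δx)
    (N : ℕ) (hN : 1 ≤ N)
    (ω : Fin (N+1) → ℝ) (hω : ∀ i, 0 < ω i)
    (D : Matrix (Fin (N+1)) (Fin (N+1)) ℝ)
    (hrows : ∀ i, (∑ m, D i m) = 0)
    (hSBP : Matrix.diagonal ω * D + (Matrix.diagonal ω * D)ᵀ
      = Matrix.diagonal (fun i => if i = 0 then (-1 : ℝ)
          else if i = Fin.last N then 1 else 0))
    (K₁ K₂ : ℕ) [NeZero K₁] [NeZero K₂]
    (Fec : Fin 2 → (Fin 9 → ℝ) → (Fin 9 → ℝ) → Fin 9 → ℝ)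
    (hFsym : ∀ (d : Fin 2) (u₁ u₂ : Fin 9 → ℝ), Fec d u₁ u₂ = Fec d u₂ u₁)
    (hFcons : ∀ (d : Fin 2) (u : Fin 9 → ℝ), 0 < u 0 → 0 < Pres γ u →
      Fec d u u = Fadv γ c_h u (Fin.castLE (by norm_num) d))
    (hFec : ∀ (d : Fin 2) (u₁ u₂ : Fin 9 → ℝ),
      0 < u₁ 0 → 0 < Pres γ u₁ → 0 < u₂ 0 → 0 < Pres γ u₂ →
      (∑ a, (entW γ u₂ a - entW γ u₁ a) * Fec d u₁ u₂ a)
        = (Psi γ c_h u₂ (Fin.castLE (by norm_num) d)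
            - Psi γ c_h u₁ (Fin.castLE (by norm_num) d))
          - ((Mag u₁ (Fin.castLE (by norm_num) d)
              + Mag u₂ (Fin.castLE (by norm_num) d)) / 2)
            * (Phi γ u₂ - Phi γ u₁))
    (U : ℝ → ZMod K₁ × ZMod K₂ → Fin (N+1) → Fin (N+1) → Fin 9 → ℝ)
    (hadm : ∀ t e i j, 0 < U t e i j 0 ∧ 0 < Pres γ (U t e i j))
    (hODE : ∀ (t : ℝ) (e : ZMod K₁ × ZMod K₂) (i j : Fin (N+1)),
      HasDerivAt (fun τ => U τ e i j)
        (dgRHS γ μ η κ R c_h α Δx N ω D (U t)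
          (fun e' => (e'.1 + 1, e'.2)) (fun e' => (e'.1 - 1, e'.2))
          (fun e' => (e'.1, e'.2 + 1)) (fun e' => (e'.1, e'.2 - 1))
          Fec e i j) t) :
    ∀ t : ℝ,
      deriv (fun τ => ∑ e : ZMod K₁ × ZMod K₂,
        (Δx ^ 2 / 4) * ∑ i, ∑ j, ω i * ω j * entS γ (U τ e i j)) t ≤ 0 := by
  intro t
  let J : ℝ := Δx ^ 2 / 4
  have hJ : 0 < J := by positivity
  let σ₁ : ZMod K₁ × ZMod K₂ ≃ ZMod K₁ × ZMod K₂ :=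
    (Equiv.addRight (1 : ZMod K₁)).prodCongr (Equiv.refl _)
  let σ₂ : ZMod K₁ × ZMod K₂ ≃ ZMod K₁ × ZMod K₂ :=
    (Equiv.refl _).prodCongr (Equiv.addRight (1 : ZMod K₂))
  let w := fun e i j => entW γ (U t e i j)
  let Fv := FvNode γ μ η κ R Δx N ω D (U t) σ₁ σ₁.symm σ₂ σ₂.symm
  let rhs := dgRHS γ μ η κ R c_h α Δx N ω D (U t) σ₁ σ₁.symm σ₂ σ₂.symm Fec
  have hODE' : ∀ e i j, HasDerivAt (fun τ => U τ e i j) (rhs e i j) t := by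
    intro e i j
    have h₁ : (σ₁.symm : ZMod K₁ × ZMod K₂ → ZMod K₁ × ZMod K₂)
        = fun e' => (e'.1 - 1, e'.2) := by
      funext e'; simp [σ₁, sub_eq_add_neg, Equiv.prodCongr_symm, Prod.map]
    have h₂ : (σ₂.symm : ZMod K₁ × ZMod K₂ → ZMod K₁ × ZMod K₂)
        = fun e' => (e'.1, e'.2 - 1) := by
      funext e'; simp [σ₂, sub_eq_add_neg, Equiv.prodCongr_symm, Prod.map]
    have h := hODE t e i j
    rw [← h₁, ← h₂] at h
    exact h
  have hderiv : HasDerivAt (fun τ => ∑ e : ZMod K₁ × ZMod K₂,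
      (Δx ^ 2 / 4) * ∑ i, ∑ j, ω i * ω j * entS γ (U τ e i j))
      (∑ e, J * ∑ i, ∑ j, ω i * ω j * ∑ a, w e i j a * rhs e i j a) t := by
    refine HasDerivAt.fun_sum fun e _ => HasDerivAt.const_mul _ ?_
    refine HasDerivAt.fun_sum fun i _ => HasDerivAt.fun_sum fun j _ => HasDerivAt.const_mul _ ?_
    exact hasDerivAt_entS hγ (hODE' e i j) (hadm t e i j).1 (hadm t e i j).2
  rw [hderiv.deriv]
  let A₁ := fun e i j a => advLine γ c_h ω D (Fec 0) 0 (fun m => U t e m j)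
    (U t (σ₁ e) 0 j) (U t (σ₁.symm e) (Fin.last N) j) i a
  let A₂ := fun e i j a => advLine γ c_h ω D (Fec 1) 1 (fun m => U t e i m)
    (U t (σ₂ e) i 0) (U t (σ₂.symm e) i (Fin.last N)) j a
  let V₁ := fun e i j a => br1Deriv ω D (fun m => Fv e m j 0 a)
    (Fv (σ₁ e) 0 j 0 a) (Fv (σ₁.symm e) (Fin.last N) j 0 a) i
  let V₂ := fun e i j a => br1Deriv ω D (fun m => Fv e i m 1 a)
    (Fv (σ₂ e) i 0 1 a) (Fv (σ₂.symm e) i (Fin.last N) 1 a) j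
  let G₁ := fun e i j a => br1Deriv ω D (fun m => w e m j a)
    (w (σ₁ e) 0 j a) (w (σ₁.symm e) (Fin.last N) j a) i
  let G₂ := fun e i j a => br1Deriv ω D (fun m => w e i m a)
    (w (σ₂ e) i 0 a) (w (σ₂.symm e) i (Fin.last N) a) j
  have hrhs : ∀ e i j a, J * rhs e i j a
      = (Δx / 2) * (A₁ e i j a + A₂ e i j a + V₁ e i j a + V₂ e i j a)
        + J * (![0, 0, 0, 0, 0, 0, 0, 0, -(α * U t e i j 8)] : Fin 9 → ℝ) a := by
    intro e i j a
    simp only [rhs, dgRHS]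
    rw [← mul_assoc, mul_one_div_cancel hJ.ne', one_mul]
    simp only [A₁, A₂, V₁, V₂, advLine, br1Deriv, Fv, J]
    split_ifs <;> ring
  have hA₁ : ∑ e, ∑ i, ∑ j, ω i * ω j * ∑ a, w e i j a * A₁ e i j a = 0 := by
    have h : ∀ j, ∑ e, ∑ i, ω i * ∑ a, w e i j a * A₁ e i j a = 0 := fun j =>
      sum_entW_mul_advLine hN hω hrows hSBP σ₁ (hFsym 0) (hFcons 0) (hFec 0)
        (fun e i => U t e i j) (fun e i => hadm t e i j)
    calc _ = ∑ j, ω j * ∑ e, ∑ i, ω i * ∑ a, w e i j a * A₁ e i j a :=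
          sum_lines_fst ω _
      _ = 0 := by simp [h]
  have hA₂ : ∑ e, ∑ i, ∑ j, ω i * ω j * ∑ a, w e i j a * A₂ e i j a = 0 := by
    have h : ∀ i, ∑ e, ∑ j, ω j * ∑ a, w e i j a * A₂ e i j a = 0 := fun i =>
      sum_entW_mul_advLine hN hω hrows hSBP σ₂ (hFsym 1) (hFcons 1) (hFec 1)
        (fun e j => U t e i j) (fun e j => hadm t e i j)
    calc _ = ∑ i, ω i * ∑ e, ∑ j, ω j * ∑ a, w e i j a * A₂ e i j a :=
          sum_lines_snd ω _
      _ = 0 := by simp [h]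
  have hV₁ : ∑ e, ∑ i, ∑ j, ω i * ω j * ∑ a, w e i j a * V₁ e i j a
      = -∑ e, ∑ i, ∑ j, ω i * ω j * ∑ a, Fv e i j 0 a * G₁ e i j a := by
    rw [sum_lines_fst, sum_lines_fst, ← Finset.sum_neg_distrib]
    refine Finset.sum_congr rfl fun j _ => ?_
    rw [← mul_neg, sum_weight_contract, sum_weight_contract, ← Finset.sum_neg_distrib]
    congr 1
    exact Finset.sum_congr rfl fun a _ => sum_mul_br1Deriv hN hω hSBP σ₁
      (fun e i => w e i j a) (fun e i => Fv e i j 0 a)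
  have hV₂ : ∑ e, ∑ i, ∑ j, ω i * ω j * ∑ a, w e i j a * V₂ e i j a
      = -∑ e, ∑ i, ∑ j, ω i * ω j * ∑ a, Fv e i j 1 a * G₂ e i j a := by
    rw [sum_lines_snd, sum_lines_snd, ← Finset.sum_neg_distrib]
    refine Finset.sum_congr rfl fun i _ => ?_
    rw [← mul_neg, sum_weight_contract, sum_weight_contract, ← Finset.sum_neg_distrib]
    congr 1
    exact Finset.sum_congr rfl fun a _ => sum_mul_br1Deriv hN hω hSBP σ₂
      (fun e j => w e i j a) (fun e j => Fv e i j 1 a)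
  have hdiss : ∀ e i j, 0 ≤ (Δx / 2) *
      ((∑ a, Fv e i j 0 a * G₁ e i j a) + ∑ a, Fv e i j 1 a * G₂ e i j a) := by
    intro e i j
    let g := BR1grad γ Δx N ω D (U t) σ₁ σ₁.symm σ₂ σ₂.symm e i j
    have hg₁ : ∀ a, g 0 a = (1 / J) * (Δx / 2) * G₁ e i j a := by
      intro a
      simp only [g, BR1grad, G₁, br1Deriv, w, J, Matrix.cons_val_zero]
      congr 2
      · congr 1
        split_ifs with h
        · rw [h]
        · rfl
      · split_ifs with h
        · rw [h]
        · rfl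
    have hg₂ : ∀ a, g 1 a = (1 / J) * (Δx / 2) * G₂ e i j a := by
      intro a
      simp only [g, BR1grad, G₂, br1Deriv, w, J, Matrix.cons_val_one, Matrix.cons_val_zero]
      congr 2
      · congr 1
        split_ifs with h
        · rw [h]
        · rfl
      · split_ifs with h
        · rw [h]
        · rfl
    have hg₃ : ∀ a, g 2 a = 0 := fun a => rfl
    have h := sum_mul_Fvisc_nonneg hμ.le hη.le hκ.le hR.le (hadm t e i j).1 (hadm t e i j).2 g
    have heq : (Δx / 2) *
        ((∑ a, Fv e i j 0 a * G₁ e i j a) + ∑ a, Fv e i j 1 a * G₂ e i j a)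
        = J * ∑ d, ∑ a, Fvisc γ μ η κ R (U t e i j) g d a * g d a := by
      simp only [Fin.sum_univ_three (fun d => ∑ a, Fvisc γ μ η κ R (U t e i j) g d a * g d a),
        hg₁, hg₂, hg₃, mul_zero, Finset.sum_const_zero, add_zero, mul_add, Finset.mul_sum]
      congr 1 <;>
      · refine Finset.sum_congr rfl fun a _ => ?_
        simp only [Fv, FvNode, g]
        field_simp
    rw [heq]
    positivity
  have hsrc : ∀ e i j, ∑ a, w e i j a *
      (J * (![0, 0, 0, 0, 0, 0, 0, 0, -(α * U t e i j 8)] : Fin 9 → ℝ) a) ≤ 0 := by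
    intro e i j
    have hβ : 0 < Beta γ (U t e i j) :=
      div_pos (hadm t e i j).1 (mul_pos two_pos (hadm t e i j).2)
    have heq : ∑ a, w e i j a *
        (J * (![0, 0, 0, 0, 0, 0, 0, 0, -(α * U t e i j 8)] : Fin 9 → ℝ) a)
        = -(J * α * (2 * Beta γ (U t e i j)) * (U t e i j 8) ^ 2) := by
      simp only [Fin.sum_univ_succ, w, entW]
      simp [Fin.succ]
      ring
    rw [heq, neg_nonpos]
    positivity
  have htotal : ∑ e, J * ∑ i, ∑ j, ω i * ω j * ∑ a, w e i j a * rhs e i j a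
      = ∑ e, ∑ i, ∑ j, ω i * ω j *
        (-((Δx / 2) * ((∑ a, Fv e i j 0 a * G₁ e i j a) + ∑ a, Fv e i j 1 a * G₂ e i j a))
          + ∑ a, w e i j a *
            (J * (![0, 0, 0, 0, 0, 0, 0, 0, -(α * U t e i j 8)] : Fin 9 → ℝ) a)) := by
    have hnode : ∀ e i j, J * (ω i * ω j * ∑ a, w e i j a * rhs e i j a)
        = (Δx / 2) * (ω i * ω j * ∑ a, w e i j a * A₁ e i j a)
          + (Δx / 2) * (ω i * ω j * ∑ a, w e i j a * A₂ e i j a)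
          + (Δx / 2) * (ω i * ω j * ∑ a, w e i j a * V₁ e i j a)
          + (Δx / 2) * (ω i * ω j * ∑ a, w e i j a * V₂ e i j a)
          + ω i * ω j * ∑ a, w e i j a *
            (J * (![0, 0, 0, 0, 0, 0, 0, 0, -(α * U t e i j 8)] : Fin 9 → ℝ) a) := by
      intro e i j
      simp only [Finset.mul_sum, ← Finset.sum_add_distrib]
      refine Finset.sum_congr rfl fun a _ => ?_
      linear_combination ω i * ω j * w e i j a * hrhs e i j a
    have hsplit : ∀ e i j, ω i * ω j *
        (-((Δx / 2) * ((∑ a, Fv e i j 0 a * G₁ e i j a) + ∑ a, Fv e i j 1 a * G₂ e i j a))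
          + ∑ a, w e i j a *
            (J * (![0, 0, 0, 0, 0, 0, 0, 0, -(α * U t e i j 8)] : Fin 9 → ℝ) a))
        = (-(Δx / 2)) * (ω i * ω j * ∑ a, Fv e i j 0 a * G₁ e i j a)
          + (-(Δx / 2)) * (ω i * ω j * ∑ a, Fv e i j 1 a * G₂ e i j a)
          + ω i * ω j * ∑ a, w e i j a *
            (J * (![0, 0, 0, 0, 0, 0, 0, 0, -(α * U t e i j 8)] : Fin 9 → ℝ) a) := by
      intro e i j
      ring
    simp only [Finset.mul_sum (a := J), hnode, hsplit]
    simp only [Finset.sum_add_distrib, ← Finset.mul_sum (a := Δx / 2),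
      ← Finset.mul_sum (a := -(Δx / 2)), hA₁, hA₂, hV₁, hV₂]
    ring
  rw [htotal]
  refine Finset.sum_nonpos fun e _ => Finset.sum_nonpos fun i _ => Finset.sum_nonpos fun j _ => ?_
  exact mul_nonpos_of_nonneg_of_nonpos (mul_pos (hω i) (hω j)).le
    (add_nonpos (neg_nonpos.2 (hdiss e i j)) (hsrc e i j))
end
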